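/- Let δ ≥ 1, k ≥ 1 be integers, let 0 < ε and d > 0 be reals, and let G = (V, E) be a geometric directed graph in ℝ^δ with n = |V| vertices whose total out-degree satisfies Σ_{v ∈ V} deg(v) ≤ d·n. Suppose G is ε-far from being a k-NN graph with respect to degree bound d, i.e., for every edge set E' ⊆ V × V such that (V, E') with the same coordinate map is a k-NN graph, the symmetric difference E Δ E' has more than ε·d·n elements. Then the number of incomplete vertices v of G that additionally satisfy deg(v) ≤ 100k/ε is at least ε·d·n / (4k). -/

import Mathlib

attribute [local instance] Classical.propDecidable

/-- The out-neighborhood `N(v)` of a vertex in a directed graph given by an edge set. -/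
noncomputable def nbrs {V : Type*} [Fintype V] (E : Finset (V × V)) (v : V) : Finset V :=
  Finset.univ.filter (fun u => (v, u) ∈ E)

/-- `(V, E)` with coordinates `coord` is a `k`-NN graph: every vertex `v` has a set `K`
of `min k (|V| - 1)` vertices other than `v`, all of them out-neighbors of `v`, that are
at least as close to `v` as every vertex outside `K ∪ {v}`. -/
def IsKNNGraph {V : Type*} [Fintype V] {δ : ℕ} (k : ℕ)
    (coord : V → EuclideanSpace ℝ (Fin δ)) (E : Finset (V × V)) : Prop :=
  ∀ v : V, ∃ K : Finset V, v ∉ K ∧ K.card = min k (Fintype.card V - 1) ∧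
    (∀ u ∈ K, (v, u) ∈ E) ∧
    ∀ u ∈ K, ∀ w : V, w ∉ K → w ≠ v →
      dist (coord v) (coord u) ≤ dist (coord v) (coord w)

/-- A vertex `v` is incomplete if `deg(v) < k` or some `k`-nearest neighbor `u` of `v`
is not an out-neighbor of `v`. -/
def Incomplete {V : Type*} [Fintype V] {δ : ℕ} (k : ℕ)
    (coord : V → EuclideanSpace ℝ (Fin δ)) (E : Finset (V × V)) (v : V) : Prop :=
  (nbrs E v).card < k ∨
    ∃ u : V, u ≠ v ∧
      (Finset.univ.filter (fun w => w ≠ v ∧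
        dist (coord v) (coord w) < dist (coord v) (coord u))).card ≤ k - 1 ∧
      (v, u) ∉ E

/-- Any finite set has a subset of prescribed size consisting of elements minimizing `f`. -/
theorem exists_subset_card_eq_forall_le {α β : Type*} [LinearOrder β] (f : α → β)
    (s : Finset α) (m : ℕ) (hm : m ≤ s.card) :
    ∃ K ⊆ s, K.card = m ∧ ∀ u ∈ K, ∀ w ∈ s, w ∉ K → f u ≤ f w := by
  induction m with
  | zero => exact ⟨∅, by simp⟩
  | succ m ih =>
    obtain ⟨K, hKs, hKc, hK⟩ := ih (by omega)
    have hne : (s \ K).Nonempty := by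
      rw [← Finset.card_pos, Finset.card_sdiff_of_subset hKs]
      omega
    obtain ⟨x, hx, hmin⟩ := Finset.exists_min_image (s \ K) f hne
    obtain ⟨hxs, hxK⟩ := Finset.mem_sdiff.mp hx
    refine ⟨insert x K, Finset.insert_subset hxs hKs, ?_, ?_⟩
    · rw [Finset.card_insert_of_notMem hxK, hKc]
    · intro u hu w hw hwK
      rw [Finset.mem_insert, not_or] at hwK
      rcases Finset.mem_insert.mp hu with rfl | hu
      · exact hmin w (Finset.mem_sdiff.mpr ⟨hw, hwK.2⟩)
      · exact hK u hu w hw hwK.2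

/-- Adding at most `k` edges at each incomplete vertex turns `E` into a `k`-NN graph. -/
theorem exists_isKNNGraph_card_symmDiff_le {V : Type*} [Fintype V] {δ k : ℕ}
    (coord : V → EuclideanSpace ℝ (Fin δ)) (E : Finset (V × V)) :
    ∃ E' : Finset (V × V), IsKNNGraph k coord E' ∧
      (symmDiff E E').card ≤ (Finset.univ.filter (Incomplete k coord E)).card * k := by
  have h : ∀ v : V, ∃ K ⊆ Finset.univ.erase v, K.card = min k (Fintype.card V - 1) ∧
      ∀ u ∈ K, ∀ w ∈ Finset.univ.erase v, w ∉ K →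
        dist (coord v) (coord u) ≤ dist (coord v) (coord w) := fun v =>
    exists_subset_card_eq_forall_le _ _ _ (by
      rw [Finset.card_erase_of_mem (Finset.mem_univ v), Finset.card_univ]
      exact min_le_right _ _)
  choose K hKs hKc hK using h
  let A := (Finset.univ.filter (Incomplete k coord E)).biUnion
    fun v => (K v).image (Prod.mk v)
  refine ⟨E ∪ A, fun v => ⟨K v, fun hv => by simpa using hKs v hv, hKc v, ?_, ?_⟩, ?_⟩
  · intro u hu
    by_cases hv : Incomplete k coord E v
    · refine Finset.mem_union_right _ (Finset.mem_biUnion.mpr ⟨v, by simpa using hv, ?_⟩)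
      exact Finset.mem_image_of_mem _ hu
    · refine Finset.mem_union_left _ ?_
      by_contra huE
      refine hv (Or.inr ⟨u, Finset.ne_of_mem_erase (hKs v hu), ?_, huE⟩)
      have hsub : (Finset.univ.filter (fun w => w ≠ v ∧
          dist (coord v) (coord w) < dist (coord v) (coord u))) ⊆ (K v).erase u := by
        intro w hw
        simp only [Finset.mem_filter, Finset.mem_univ, true_and] at hw
        refine Finset.mem_erase.mpr ⟨fun h => by simp [h] at hw, ?_⟩
        by_contra hwK
        exact absurd hw.2 (not_lt.mpr (hK v u hu w (by simpa using hw.1) hwK))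
      refine (Finset.card_le_card hsub).trans ?_
      rw [Finset.card_erase_of_mem hu, hKc v]
      exact Nat.sub_le_sub_right (min_le_left _ _) 1
  · intro u hu w hw hwv
    exact hK v u hu w (by simpa using hwv) hw
  · have hsub : symmDiff E (E ∪ A) ⊆ A := by
      intro e he
      simp only [Finset.mem_symmDiff, Finset.mem_union] at he
      tauto
    refine (Finset.card_le_card hsub).trans (Finset.card_biUnion_le_card_mul _ _ _ ?_)
    intro v _
    exact Finset.card_image_le.trans ((hKc v).trans_le (min_le_left _ _))

/-- claim in the correctness proof of Theorem 1: if the total out-degree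
is at most `d·n` and `G` is `ε`-far from being a `k`-NN graph, then at least
`ε·d·n / (4k)` vertices are incomplete and have degree at most `100k/ε`. -/
theorem stmt4 (δ k : ℕ) (hδ : 1 ≤ δ) (hk : 1 ≤ k) (ε d : ℝ) (hε : 0 < ε) (hd : 0 < d)
    (V : Type*) [Fintype V] (coord : V → EuclideanSpace ℝ (Fin δ)) (E : Finset (V × V))
    (hdeg : (∑ v : V, ((nbrs E v).card : ℝ)) ≤ d * (Fintype.card V : ℝ))
    (hfar : ∀ E' : Finset (V × V), IsKNNGraph k coord E' →
      ε * d * (Fintype.card V : ℝ) < ((symmDiff E E').card : ℝ)) :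
    ε * d * (Fintype.card V : ℝ) / (4 * k) ≤
      ((Finset.univ.filter (fun v => Incomplete k coord E v ∧
        ((nbrs E v).card : ℝ) ≤ 100 * k / ε)).card : ℝ) := by
  obtain ⟨E', hE', hcard⟩ := exists_isKNNGraph_card_symmDiff_le (k := k) coord E
  have hk0 : (0 : ℝ) < k := by exact_mod_cast hk
  have hI : ε * d * (Fintype.card V : ℝ) <
      ((Finset.univ.filter (Incomplete k coord E)).card : ℝ) * k :=
    (hfar E' hE').trans_le (by exact_mod_cast hcard)
  let H := Finset.univ.filter fun v => 100 * (k : ℝ) / ε < ((nbrs E v).card : ℝ)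
  have hH : (H.card : ℝ) * (100 * k / ε) ≤ d * (Fintype.card V : ℝ) := by
    refine le_trans ?_ hdeg
    rw [← nsmul_eq_mul]
    refine (Finset.card_nsmul_le_sum H (fun v => ((nbrs E v).card : ℝ)) _
      fun v hv => (Finset.mem_filter.mp hv).2.le).trans ?_
    exact Finset.sum_le_sum_of_subset_of_nonneg (Finset.subset_univ _)
      fun _ _ _ => Nat.cast_nonneg _
  rw [← mul_div_assoc, div_le_iff₀ hε] at hH
  set L := Finset.univ.filter fun v => Incomplete k coord E v ∧
    ((nbrs E v).card : ℝ) ≤ 100 * k / ε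
  have hsub : Finset.univ.filter (Incomplete k coord E) ⊆ L ∪ H := by
    intro v hv
    simp only [L, H, Finset.mem_union, Finset.mem_filter, Finset.mem_univ, true_and] at hv ⊢
    rcases le_or_gt ((nbrs E v).card : ℝ) (100 * k / ε) with h | h
    · exact Or.inl ⟨hv, h⟩
    · exact Or.inr h
  have hLH : ((Finset.univ.filter (Incomplete k coord E)).card : ℝ) ≤ L.card + H.card := by
    exact_mod_cast (Finset.card_le_card hsub).trans (Finset.card_union_le _ _)
  have hmul := mul_le_mul_of_nonneg_right hLH hk0.le
  have hn : 0 ≤ ε * d * (Fintype.card V : ℝ) := by positivity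
  rw [div_le_iff₀ (by positivity)]
  linarith
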